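/- arXiv:2510.14568 — 4 statements merged into one kernel-verified Lean document; each statement's English description precedes it below -/
import Mathlib

section
/- Let p > 1 be a prime number, n ∈ ℕ, and let G = (ℤ/pℤ)^n. Let F be an injective group cellular automaton on G. Then F is expansive if and only if the group cellular automaton H = F − F^{−1} on G (defined pointwise by H(c) = F(c) − F^{−1}(c)) is positively expansive. -/
open Function Topology

/-- The prodiscrete (product of discrete) topology on configurations `ℤ → A`. -/
def configTop (A : Type*) : TopologicalSpace (ℤ → A) :=
  @Pi.topologicalSpace ℤ (fun _ => A) (fun _ => ⊥)

/-- The shift map. -/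
def shiftMap (A : Type*) : (ℤ → A) → (ℤ → A) := fun c i => c (i + 1)

open Classical in
/-- The Tychonoff distance on configurations. -/
noncomputable def tychDist {A : Type*} (c c' : ℤ → A) : ℝ :=
  if c = c' then 0
  else (2 : ℝ) ^ (-((sInf {n : ℕ | ∃ j : ℤ, j.natAbs = n ∧ c j ≠ c' j} : ℕ) : ℤ))

/-- The `n`-th iterate, `n ∈ ℤ`, of a map (negative powers via `Function.invFun`,
which is the genuine inverse whenever the map is bijective). -/
noncomputable def zIter {A : Type*} [Nonempty A] (F : (ℤ → A) → (ℤ → A)) (n : ℤ) :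
    (ℤ → A) → (ℤ → A) :=
  if 0 ≤ n then F^[n.toNat] else (Function.invFun F)^[(-n).toNat]

/-- Expansivity (for reversible maps). -/
def Expansive {A : Type*} [Nonempty A] (F : (ℤ → A) → (ℤ → A)) : Prop :=
  ∃ ε : ℝ, 0 < ε ∧ ∀ c c' : ℤ → A, c ≠ c' →
    ∃ n : ℤ, tychDist (zIter F n c) (zIter F n c') > ε

/-- Positive expansivity. -/
def PosExpansive {A : Type*} (F : (ℤ → A) → (ℤ → A)) : Prop :=
  ∃ ε : ℝ, 0 < ε ∧ ∀ c c' : ℤ → A, c ≠ c' →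
    ∃ n : ℕ, tychDist (F^[n] c) (F^[n] c') > ε

/-- Topological transitivity (w.r.t. the prodiscrete topology). -/
def TopTransitive {A : Type*} (F : (ℤ → A) → (ℤ → A)) : Prop :=
  ∀ U V : Set (ℤ → A), IsOpen[configTop A] U → IsOpen[configTop A] V →
    U.Nonempty → V.Nonempty → ∃ n : ℕ, (F^[n] '' U ∩ V).Nonempty

/-- Left fronts (additive). -/
def Lset (G : Type*) [Zero G] (k : ℤ) : Set (ℤ → G) := {c | c k ≠ 0 ∧ ∀ i > k, c i = 0}

/-- Agreement of two configurations on the window `[-r, r]`. -/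
def AgreeOn {A : Type*} (r : ℕ) (c c' : ℤ → A) : Prop :=
  ∀ j : ℤ, j.natAbs ≤ r → c j = c' j

/-- The subgroup of configurations vanishing on the window `[-r, r]`. -/
def windowKer (A : Type*) [AddCommGroup A] (r : ℕ) : AddSubgroup (ℤ → A) where
  carrier := {c | ∀ j : ℤ, j.natAbs ≤ r → c j = 0}
  add_mem' ha hb j hj := by simp [ha j hj, hb j hj]
  zero_mem' _ _ := rfl
  neg_mem' ha j hj := by simp [ha j hj]

theorem sub_mem_windowKer {A : Type*} [AddCommGroup A] {r : ℕ} {c c' : ℤ → A} :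
    c - c' ∈ windowKer A r ↔ AgreeOn r c c' :=
  forall₂_congr fun _ _ => sub_eq_zero

theorem windowKer_anti {A : Type*} [AddCommGroup A] : Antitone (windowKer A) :=
  fun _ _ h _ hc j hj => hc j (hj.trans h)

theorem not_agreeOn_of_lt_tychDist {A : Type*} {c c' : ℤ → A} {r : ℕ}
    (h : (2 : ℝ) ^ (-(r : ℤ)) < tychDist c c') : ¬ AgreeOn r c c' := by
  intro ha
  by_cases hc : c = c'
  · rw [tychDist, if_pos hc] at h
    exact absurd h (not_lt.2 (by positivity))
  · rw [tychDist, if_neg hc, zpow_lt_zpow_iff_right₀ one_lt_two] at h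
    obtain ⟨j, hj⟩ := Function.ne_iff.1 hc
    obtain ⟨k, hk, hne⟩ := Nat.sInf_mem
      (s := {n : ℕ | ∃ j : ℤ, j.natAbs = n ∧ c j ≠ c' j}) ⟨_, j, rfl, hj⟩
    exact hne (ha k (by omega))

theorem lt_tychDist_of_not_agreeOn {A : Type*} {c c' : ℤ → A} {r : ℕ}
    (h : ¬ AgreeOn r c c') : (2 : ℝ) ^ (-((r + 1 : ℕ) : ℤ)) < tychDist c c' := by
  simp only [AgreeOn, not_forall] at h
  obtain ⟨j, hj, hne⟩ := h
  have hc : c ≠ c' := fun e => hne (congrFun e j)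
  rw [tychDist, if_neg hc, zpow_lt_zpow_iff_right₀ one_lt_two]
  have := Nat.sInf_le (s := {n : ℕ | ∃ j : ℤ, j.natAbs = n ∧ c j ≠ c' j}) ⟨j, rfl, hne⟩
  omega

/-- Metric separation along a family of maps is separation by a common finite window. -/
theorem exists_separating_radius_iff {A ι : Type*} (Φ : ι → (ℤ → A) → (ℤ → A)) :
    (∃ ε : ℝ, 0 < ε ∧ ∀ c c' : ℤ → A, c ≠ c' → ∃ i, tychDist (Φ i c) (Φ i c') > ε) ↔
      ∃ r : ℕ, ∀ c c' : ℤ → A, (∀ i, AgreeOn r (Φ i c) (Φ i c')) → c = c' := by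
  constructor
  · rintro ⟨ε, hε, h⟩
    obtain ⟨r, hr⟩ := exists_pow_lt_of_lt_one hε (y := (2⁻¹ : ℝ)) (by norm_num)
    refine ⟨r, fun c c' ha => by_contra fun hne => ?_⟩
    obtain ⟨i, hi⟩ := h c c' hne
    refine not_agreeOn_of_lt_tychDist (lt_trans ?_ hi) (ha i)
    rwa [zpow_neg, zpow_natCast, ← inv_pow]
  · rintro ⟨r, h⟩
    refine ⟨(2 : ℝ) ^ (-((r + 1 : ℕ) : ℤ)), by positivity, fun c c' hne => ?_⟩
    by_contra! hi
    exact hne (h c c' fun i => by_contra fun hn => (lt_tychDist_of_not_agreeOn hn).not_ge (hi i))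

/-- For additive maps, separation by a window can be tested against the zero configuration. -/
theorem exists_separating_radius_iff_of_additive {A ι : Type*} [AddCommGroup A]
    (Φ : ι → (ℤ → A) → (ℤ → A)) (hΦ : ∀ i c c', Φ i (c - c') = Φ i c - Φ i c') :
    (∃ ε : ℝ, 0 < ε ∧ ∀ c c' : ℤ → A, c ≠ c' → ∃ i, tychDist (Φ i c) (Φ i c') > ε) ↔
      ∃ r : ℕ, ∀ c : ℤ → A, (∀ i, Φ i c ∈ windowKer A r) → c = 0 := by
  rw [exists_separating_radius_iff]
  refine exists_congr fun r => ⟨fun h c hc => h c 0 fun i => ?_, fun h c c' hc => ?_⟩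
  · rw [← sub_mem_windowKer, ← hΦ, sub_zero]
    exact hc i
  · refine sub_eq_zero.1 (h _ fun i => ?_)
    rw [hΦ, sub_mem_windowKer]
    exact hc i

/-- A continuous map fixing `0` is local: small windows of the image are controlled by
large windows of the argument. -/
theorem exists_windowKer_le_preimage {A : Type*} [AddCommGroup A] (F : (ℤ → A) → (ℤ → A))
    (hcont : Continuous[configTop A, configTop A] F) (h0 : F 0 = 0) (r : ℕ) :
    ∃ R : ℕ, ∀ c ∈ windowKer A R, F c ∈ windowKer A r := by
  let : TopologicalSpace A := ⊥
  have : DiscreteTopology A := ⟨rfl⟩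
  have hopen : IsOpen {c : ℤ → A | ∀ j ∈ Finset.Icc (-(r : ℤ)) r, c j = 0} := by
    have : {c : ℤ → A | ∀ j ∈ Finset.Icc (-(r : ℤ)) r, c j = 0} =
        Set.pi (Finset.Icc (-(r : ℤ)) r : Finset ℤ) fun _ => {0} := by ext; simp [Set.mem_pi]
    rw [this]
    exact isOpen_set_pi (Finset.finite_toSet _) fun _ _ => isOpen_discrete _
  have hpre := hopen.preimage (show Continuous F from hcont)
  obtain ⟨I, u, hu, hsub⟩ := isOpen_pi_iff.1 hpre 0 (by simp [h0])
  refine ⟨I.sup Int.natAbs, fun c hc j hj => ?_⟩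
  refine hsub (a := c) (fun i hi => ?_) j (Finset.mem_Icc.2 (by omega))
  rw [hc i (Finset.le_sup (f := Int.natAbs) hi)]
  exact (hu i hi).2

theorem shiftMap_iterate_apply {A : Type*} (k : ℕ) (c : ℤ → A) (i : ℤ) :
    (shiftMap A)^[k] c i = c (i + k) := by
  induction k generalizing c with
  | zero => simp
  | succ k ih =>
    rw [Function.iterate_succ_apply, ih, shiftMap]
    congr 1
    push_cast
    ring

theorem finite_periodicConfig {A : Type*} [Finite A] {k : ℕ} (hk : 0 < k) :
    {c : ℤ → A | (shiftMap A)^[k] c = c}.Finite := by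
  refine Set.Finite.of_injOn (f := fun c (i : Fin k) => c (i : ℕ)) (t := Set.univ)
    (fun _ _ => Set.mem_univ _) ?_ Set.finite_univ
  intro c hc c' hc' h
  have key : ∀ d : ℤ → A, (shiftMap A)^[k] d = d → ∀ i, d i = d (i % k) := by
    intro d hd i
    have hp : Function.Periodic d (k : ℤ) := fun j =>
      (shiftMap_iterate_apply k d j).symm.trans (congrFun hd j)
    rw [Int.emod_def, mul_comm]
    exact (hp.sub_int_mul_eq _).symm
  funext i
  rw [key c hc, key c' hc']
  have h1 := Int.emod_nonneg i (b := k) (by omega)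
  have h2 := Int.emod_lt_of_pos i (b := k) (by omega)
  have := congrFun h ⟨(i % k).toNat, by omega⟩
  simpa [Int.toNat_of_nonneg h1] using this

/-- An injective cellular automaton is surjective. -/
theorem surjective_of_injective_cellularAutomaton {A : Type*} [Finite A]
    (F : (ℤ → A) → (ℤ → A)) (hcont : Continuous[configTop A, configTop A] F)
    (hshift : F ∘ shiftMap A = shiftMap A ∘ F) (hinj : Function.Injective F) :
    Function.Surjective F := by
  let : TopologicalSpace A := ⊥
  have : DiscreteTopology A := ⟨rfl⟩
  have hclosed : IsClosed (Set.range F) := (isCompact_range (show Continuous F from hcont)).isClosed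
  have hperiodic : ∀ k : ℕ, 0 < k → ∀ c, (shiftMap A)^[k] c = c → c ∈ Set.range F := by
    intro k hk c hc
    have hmaps : Set.MapsTo F {c | (shiftMap A)^[k] c = c} {c | (shiftMap A)^[k] c = c} := by
      intro d hd
      have hcomm : Function.Commute F (shiftMap A) := congrFun hshift
      change (shiftMap A)^[k] (F d) = F d
      rw [← (hcomm.iterate_right k).eq, hd]
    obtain ⟨d, -, hd⟩ := (((finite_periodicConfig hk).injOn_iff_bijOn_of_mapsTo hmaps).1 hinj.injOn).surjOn hc
    exact ⟨d, hd⟩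
  intro c
  change c ∈ Set.range F
  rw [← hclosed.closure_eq, mem_closure_iff]
  intro o ho hco
  obtain ⟨I, u, hu, hsub⟩ := isOpen_pi_iff.1 ho c hco
  set r := I.sup Int.natAbs
  set k := 2 * r + 1 with hk
  let d : ℤ → A := fun i => c ((i + r) % k - r)
  refine ⟨d, hsub fun i hi => ?_, hperiodic k (by omega) d ?_⟩
  · have hir : i.natAbs ≤ r := Finset.le_sup (f := Int.natAbs) hi
    have : d i = c i := by
      change c _ = c i
      rw [Int.emod_eq_of_lt (by omega) (by omega), add_sub_cancel_right]
    rw [this]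
    exact (hu i hi).2
  · funext i
    rw [shiftMap_iterate_apply]
    change c _ = c _
    rw [add_right_comm, Int.add_emod_right]

section InverseDifference

variable {E : Type*} [AddCommGroup E] (f g : E →+ E) (S : AddSubgroup E)

theorem sub_iterate_mem (hfg : ∀ x, f (g x) = x) (hgf : ∀ x, g (f x) = x) (m : ℕ) {x : E}
    (hf : ∀ n : ℕ, f^[n] x ∈ S) (hg : ∀ n : ℕ, g^[n] x ∈ S) : (f - g)^[m] x ∈ S := by
  induction m generalizing x with
  | zero => exact hf 0
  | succ m ih =>
    rw [Function.iterate_succ_apply]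
    refine ih (fun n => ?_) (fun n => ?_)
    · rw [AddMonoidHom.sub_apply, iterate_map_sub]
      refine S.sub_mem (hf (n + 1)) ?_
      cases n with
      | zero => exact hg 1
      | succ n =>
        rw [Function.iterate_succ_apply, hfg]
        exact hf n
    · rw [AddMonoidHom.sub_apply, iterate_map_sub]
      refine S.sub_mem ?_ (hg (n + 1))
      cases n with
      | zero => exact hf 1
      | succ n =>
        rw [Function.iterate_succ_apply, hgf]
        exact hg n

theorem iterate_mem_of_sub_iterate_mem (hgf : ∀ x, g (f x) = x) (n : ℕ) {x : E}
    (h : ∀ m : ℕ, (f - g)^[m] x ∈ S) (h' : ∀ m : ℕ, (f - g)^[m] (f x) ∈ S) :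
    f^[n] x ∈ S := by
  induction n generalizing x with
  | zero => exact h 0
  | succ n ih =>
    rw [Function.iterate_succ_apply]
    refine ih h' fun m => ?_
    have hx : f (f x) = (f - g) (f x) + x := by simp [hgf]
    rw [hx, iterate_map_add]
    exact S.add_mem (h' (m + 1)) (h m)

theorem inverse_iterate_mem_of_sub_iterate_mem (hfg : ∀ x, f (g x) = x) (n : ℕ) {x : E}
    (h : ∀ m : ℕ, (f - g)^[m] x ∈ S) (h' : ∀ m : ℕ, (f - g)^[m] (f x) ∈ S) :
    g^[n] x ∈ S := by
  induction n generalizing x with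
  | zero => exact h 0
  | succ n ih =>
    rw [Function.iterate_succ_apply]
    refine ih (fun m => ?_) fun m => by rw [hfg]; exact h m
    have hx : g x = f x - (f - g) x := by simp
    rw [hx, iterate_map_sub]
    exact S.sub_mem (h' m) (h (m + 1))

end InverseDifference

theorem zIter_mem_iff {A : Type*} [AddCommGroup A] (F : (ℤ → A) → (ℤ → A))
    (S : AddSubgroup (ℤ → A)) (c : ℤ → A) :
    (∀ n : ℤ, zIter F n c ∈ S) ↔
      (∀ n : ℕ, F^[n] c ∈ S) ∧ ∀ n : ℕ, (Function.invFun F)^[n] c ∈ S := by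
  refine ⟨fun h => ⟨fun n => by simpa [zIter] using h n, fun n => ?_⟩, fun h n => ?_⟩
  · cases n with
    | zero => simpa [zIter] using h 0
    | succ n =>
      have := h (-((n + 1 : ℕ) : ℤ))
      rwa [zIter, if_neg (by omega), neg_neg, Int.toNat_natCast] at this
  · unfold zIter
    split_ifs
    exacts [h.1 _, h.2 _]

/-- An injective group cellular automaton `F` on a finite abelian group is expansive iff
`F - F⁻¹` is positively expansive. -/
theorem expansive_iff_posExpansive_sub_inv {A : Type*} [AddCommGroup A] [Finite A]
    (F : (ℤ → A) → (ℤ → A)) (hcont : Continuous[configTop A, configTop A] F)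
    (hshift : F ∘ shiftMap A = shiftMap A ∘ F) (hhom : ∀ c c', F (c + c') = F c + F c')
    (hinj : Function.Injective F) :
    Expansive F ↔ PosExpansive (fun c => F c - Function.invFun F c) := by
  have hgf : ∀ c, Function.invFun F (F c) = c := Function.leftInverse_invFun hinj
  have hfg : ∀ c, F (Function.invFun F c) = c := Function.rightInverse_invFun
    (surjective_of_injective_cellularAutomaton F hcont hshift hinj)
  let f : (ℤ → A) →+ (ℤ → A) := AddMonoidHom.mk' F hhom
  let g : (ℤ → A) →+ (ℤ → A) := AddMonoidHom.mk' (Function.invFun F) fun c c' =>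
    hinj (by rw [hhom, hfg, hfg, hfg])
  have hcomm : Function.Commute f ⇑(f - g) := fun c => by
    change F (F c - Function.invFun F c) = F (F c) - Function.invFun F (F c)
    rw [hgf, ← hfg c]
    exact (map_sub f _ _).trans (by simp [f, hfg])
  have hz : ∀ (n : ℤ) (c c' : ℤ → A), zIter F n (c - c') = zIter F n c - zIter F n c' := by
    intro n c c'
    unfold zIter
    split_ifs
    exacts [iterate_map_sub f _ c c', iterate_map_sub g _ c c']
  refine (exists_separating_radius_iff_of_additive (zIter F) hz).trans
    (Iff.trans ?_ (exists_separating_radius_iff_of_additive (fun m : ℕ => (f - g)^[m])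
      fun m => iterate_map_sub (f - g) m).symm)
  constructor
  · rintro ⟨r, h⟩
    obtain ⟨R, hR⟩ := exists_windowKer_le_preimage F hcont (map_zero f) r
    refine ⟨max r R, fun c hc => h c ((zIter_mem_iff F _ c).2 ?_)⟩
    have h1 : ∀ m : ℕ, (f - g)^[m] c ∈ windowKer A r := fun m =>
      windowKer_anti (le_max_left r R) (hc m)
    have h2 : ∀ m : ℕ, (f - g)^[m] (f c) ∈ windowKer A r := fun m => by
      rw [← (hcomm.iterate_right m).eq]
      exact hR _ (windowKer_anti (le_max_right r R) (hc m))
    exact ⟨fun n => iterate_mem_of_sub_iterate_mem f g _ hgf n h1 h2,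
      fun n => inverse_iterate_mem_of_sub_iterate_mem f g _ hfg n h1 h2⟩
  · rintro ⟨r, h⟩
    refine ⟨r, fun c hc => h c fun m => ?_⟩
    obtain ⟨hF, hG⟩ := (zIter_mem_iff F _ c).1 hc
    exact sub_iterate_mem f g _ hfg hgf m hF hG

/-- for an injective GCA `F` on `(ℤ/pℤ)^n`, `p` prime, `F` is expansive iff
`H = F - F⁻¹` is positively expansive. -/
theorem expansive_iff_posExpansive_sub_inv_zmodp (p : ℕ) (hp : p.Prime) (n : ℕ)
    (F : (ℤ → (Fin n → ZMod p)) → (ℤ → (Fin n → ZMod p)))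
    (hcont : Continuous[configTop (Fin n → ZMod p), configTop (Fin n → ZMod p)] F)
    (hshift : F ∘ shiftMap (Fin n → ZMod p) = shiftMap (Fin n → ZMod p) ∘ F)
    (hhom : ∀ c c' : ℤ → (Fin n → ZMod p), F (c + c') = F c + F c')
    (hinj : Function.Injective F) :
    Expansive F ↔ PosExpansive (fun c => F c - Function.invFun F c) := by
  have : NeZero p := ⟨hp.ne_zero⟩
  exact expansive_iff_posExpansive_sub_inv F hcont hshift hhom hinj
end

section
/- Let G be a finite abelian group and let F be an injective group cellular automaton on G. If there exist an integer n ≥ 1 and a finite configuration c ≠ 0^ℤ (i.e., c_i = 0 for all but finitely many i ∈ ℤ) such that F^n(c) = c, then F is not expansive. -/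
open Function Topology

/-- Configurations agreeing on `[-N, N]` are at distance at most `2⁻ᴺ`. -/
theorem tychDist_le_of_eqOn {A : Type*} {c c' : ℤ → A} {N : ℕ}
    (h : ∀ i : ℤ, i.natAbs ≤ N → c i = c' i) : tychDist c c' ≤ (1 / 2 : ℝ) ^ N := by
  unfold tychDist
  split_ifs with hc
  · positivity
  · obtain ⟨j, hj⟩ := Function.ne_iff.mp hc
    have hle : N ≤ sInf {n : ℕ | ∃ j : ℤ, j.natAbs = n ∧ c j ≠ c' j} := by
      refine le_csInf ⟨_, j, rfl, hj⟩ ?_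
      rintro _ ⟨i, rfl, hi⟩
      by_contra hlt
      exact hi (h i (not_le.mp hlt).le)
    rw [zpow_neg, zpow_natCast, ← inv_pow, ← one_div]
    exact pow_le_pow_of_le_one (by norm_num) (by norm_num) hle

theorem zIter_eq_of_isFixedPt {A : Type*} [Nonempty A] {F : (ℤ → A) → (ℤ → A)} {x : ℤ → A}
    (hinj : Injective F) (hx : IsFixedPt F x) (m : ℤ) : zIter F m x = x := by
  unfold zIter
  split_ifs
  · exact iterate_fixed hx _
  · refine iterate_fixed ?_ _
    conv_lhs => rw [← hx.eq]
    exact leftInverse_invFun hinj x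

/-- The two-sided orbit of a periodic point is its forward orbit over one period. -/
theorem exists_zIter_eq_iterate {A : Type*} [Nonempty A] {F : (ℤ → A) → (ℤ → A)} {x : ℤ → A}
    {n : ℕ} (hinj : Injective F) (hn : 0 < n) (hx : IsPeriodicPt F n x) (m : ℤ) :
    ∃ j < n, zIter F m x = F^[j] x := by
  suffices h : ∃ j, zIter F m x = F^[j] x by
    obtain ⟨j, hj⟩ := h
    exact ⟨j % n, Nat.mod_lt _ hn, by rw [hj, hx.iterate_mod_apply]⟩
  unfold zIter
  split_ifs
  · exact ⟨_, rfl⟩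
  · set p := (-m).toNat
    refine ⟨n * p - p, ?_⟩
    have hp : F^[p] (F^[n * p - p] x) = x := by
      rw [← iterate_add_apply, Nat.add_sub_cancel' (Nat.le_mul_of_pos_left p hn)]
      exact hx.mul_const p
    conv_lhs => rw [← hp]
    exact (leftInverse_invFun hinj).iterate p _

theorem tendsto_shiftMap_iterate {G : Type*} [Zero G] {c : ℤ → G}
    (hfin : {i : ℤ | c i ≠ 0}.Finite) :
    Filter.Tendsto (fun k => (shiftMap G)^[k] c) Filter.atTop (@nhds _ (configTop G) 0) := by
  let _ : TopologicalSpace G := ⊥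
  refine tendsto_pi_nhds.mpr fun i => ?_
  obtain ⟨b, hb⟩ := hfin.bddAbove
  refine tendsto_const_nhds.congr' ?_
  filter_upwards [Filter.eventually_gt_atTop (b - i).toNat] with k hk
  rw [shiftMap_iterate_apply]
  by_contra h
  have : i + (k : ℤ) ≤ b := hb (Ne.symm h)
  omega

/-- if an injective GCA on a finite abelian group has a nonzero finite periodic
configuration, then it is not expansive. -/
theorem not_expansive_of_finite_periodic {G : Type*} [AddCommGroup G] [Fintype G]
    (F : (ℤ → G) → (ℤ → G))
    (hcont : Continuous[configTop G, configTop G] F)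
    (hshift : F ∘ shiftMap G = shiftMap G ∘ F)
    (hhom : ∀ c c' : ℤ → G, F (c + c') = F c + F c')
    (hinj : Function.Injective F)
    (n : ℕ) (hn : 1 ≤ n) (c : ℤ → G)
    (hfin : {i : ℤ | c i ≠ 0}.Finite) (hc0 : c ≠ fun _ => 0)
    (hfix : F^[n] c = c) :
    ¬ Expansive F := by
  rintro ⟨ε, hε, hexp⟩
  obtain ⟨N, hN⟩ := exists_pow_lt_of_lt_one hε (by norm_num : (1 / 2 : ℝ) < 1)
  have hF0 : F 0 = 0 := by simpa using hhom 0 0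
  have hcomm : Function.Commute F (shiftMap G) := congrFun hshift
  have hsmall : ∀ j : ℕ, ∀ᶠ k in Filter.atTop,
      ∀ i : ℤ, i.natAbs ≤ N → F^[j] ((shiftMap G)^[k] c) i = 0 := by
    intro j
    let _ : TopologicalSpace G := ⊥
    have : DiscreteTopology G := ⟨rfl⟩
    have hF : Continuous F := hcont
    have hlim : Filter.Tendsto (fun k => F^[j] ((shiftMap G)^[k] c)) Filter.atTop (𝓝 0) := by
      have h := ((hF.iterate j).tendsto 0).comp (tendsto_shiftMap_iterate hfin)
      rwa [iterate_fixed hF0 j] at h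
    have hIcc : ∀ᶠ k in Filter.atTop,
        ∀ i ∈ Set.Icc (-(N : ℤ)) N, F^[j] ((shiftMap G)^[k] c) i = 0 := by
      refine (Set.finite_Icc _ _).eventually_all.mpr fun i _ => ?_
      have h := tendsto_pi_nhds.mp hlim i
      rw [nhds_discrete] at h
      exact Filter.tendsto_pure.mp h
    exact hIcc.mono fun k hk i hi => hk i ⟨by omega, by omega⟩
  obtain ⟨k, hk⟩ := ((Set.finite_lt_nat n).eventually_all.mpr fun j _ => hsmall j).exists
  set d := (shiftMap G)^[k] c with hd
  have hper : IsPeriodicPt F n d := by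
    change F^[n] d = d
    rw [hd, (hcomm.iterate_iterate n k).eq, hfix]
  have hd0 : d ≠ 0 := by
    obtain ⟨i, hi⟩ := Function.ne_iff.mp hc0
    refine Function.ne_iff.mpr ⟨i - k, ?_⟩
    rw [hd, shiftMap_iterate_apply]
    simpa using hi
  obtain ⟨m, hm⟩ := hexp d 0 hd0
  obtain ⟨j, hj, hjm⟩ := exists_zIter_eq_iterate hinj hn hper m
  rw [hjm, zIter_eq_of_isFixedPt hinj hF0] at hm
  exact absurd (tychDist_le_of_eqOn (hk j hj)) (not_le.mpr (hN.trans hm))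
end

section
/- Let G be a finite abelian group, let F be an injective group cellular automaton on G, and let n ≥ 1 be an integer. If the group cellular automaton F^n − I on G (where I is the identity map and the difference is taken pointwise) is not surjective, then there exists a finite configuration c ≠ 0^ℤ such that F^n(c) = c. -/
open Function Topology

/-- Bernoulli's inequality for `1 + 1 / b`, with denominators cleared. -/
theorem add_mul_pow_le_mul_succ_pow (b k : ℕ) : (b + k) * b ^ k ≤ b * (b + 1) ^ k := by
  induction k with
  | zero => simp
  | succ k ih =>
    calc (b + (k + 1)) * b ^ (k + 1) = (b * b + b * k + b) * b ^ k := by ring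
      _ ≤ (b + 1) * ((b + k) * b ^ k) := by
        rw [← mul_assoc]
        exact Nat.mul_le_mul_right _ (by nlinarith)
      _ ≤ (b + 1) * (b * (b + 1) ^ k) := Nat.mul_le_mul_left _ ih
      _ = b * (b + 1) ^ (k + 1) := by ring

theorem mul_pow_lt_succ_pow (b C k : ℕ) (hk : b * C < k) : C * b ^ k < (b + 1) ^ k := by
  rcases Nat.eq_zero_or_pos b with rfl | hb
  · rw [zero_pow (by omega)]
    simp
  · have h := add_mul_pow_le_mul_succ_pow b k
    have hpow : 0 < b ^ k := Nat.pow_pos hb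
    have h' : b * (C * b ^ k) < b * (b + 1) ^ k := by
      refine lt_of_lt_of_le ?_ h
      rw [← mul_assoc]
      exact Nat.mul_lt_mul_of_pos_right (by omega) hpow
    exact Nat.lt_of_mul_lt_mul_left h'

/-- A map commuting with the shift commutes with every translation of `ℤ`. -/
theorem translate_of_comp_shiftMap {A : Type*} {F : (ℤ → A) → (ℤ → A)}
    (hF : F ∘ shiftMap A = shiftMap A ∘ F) (a : ℤ) :
    ∀ (c : ℤ → A) (i : ℤ), F (fun j => c (j + a)) i = F c (i + a) := by
  have step (c : ℤ → A) (i : ℤ) : F (fun j => c (j + 1)) i = F c (i + 1) :=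
    congrFun (congrFun hF c) i
  induction a using Int.induction_on with
  | zero => simp
  | succ a ih =>
    intro c i
    have h := step (fun j => c (j + a)) i
    rw [ih] at h
    rw [← add_assoc, add_right_comm, ← h]
    congr 1
    funext j
    congr 1
    ring
  | pred a ih =>
    intro c i
    have h := step (fun j => c (j + (-a - 1))) (i - 1)
    rw [sub_add_cancel] at h
    rw [← h, show i + (-(a : ℤ) - 1) = i - 1 + -a by ring, ← ih]
    congr 1
    funext j
    congr 1
    ring

/-- A continuous additive map depends at position `0` on boundedly many cells only. -/
theorem exists_radius_of_continuous {G : Type*} [AddCommGroup G] [TopologicalSpace G]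
    [DiscreteTopology G] (H : (ℤ → G) →+ (ℤ → G)) (hH : Continuous H) :
    ∃ r : ℕ, ∀ c : ℤ → G, (∀ i : ℤ, i.natAbs ≤ r → c i = 0) → H c 0 = 0 := by
  have hopen : IsOpen {c : ℤ → G | H c 0 = 0} :=
    (isOpen_discrete ({0} : Set G)).preimage ((continuous_apply 0).comp hH)
  obtain ⟨I, u, hu, hsub⟩ := isOpen_pi_iff.1 hopen 0 (by simp)
  refine ⟨I.sup Int.natAbs, fun c hc => hsub fun i hi => ?_⟩
  rw [hc i (Finset.le_sup (f := Int.natAbs) hi)]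
  exact (hu i hi).2

/-- A continuous non-surjective map misses some pattern on a window `[-s, s]`. -/
theorem exists_orphan_of_not_surjective {G : Type*} [Finite G] [TopologicalSpace G]
    [DiscreteTopology G] {H : (ℤ → G) → (ℤ → G)} (hH : Continuous H)
    (hns : ¬ Function.Surjective H) :
    ∃ (s : ℕ) (y : ℤ → G), ∀ c : ℤ → G, ∃ i : ℤ, i.natAbs ≤ s ∧ H c i ≠ y i := by
  obtain ⟨y, hy⟩ := not_forall.1 hns
  have hopen : IsOpen (Set.range H)ᶜ := (isCompact_range hH).isClosed.isOpen_compl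
  obtain ⟨I, u, hu, hsub⟩ := isOpen_pi_iff.1 hopen y hy
  refine ⟨I.sup Int.natAbs, y, fun c => ?_⟩
  by_contra! h
  refine hsub (a := H c) (fun i hi => ?_) ⟨c, rfl⟩
  rw [h i (Finset.le_sup (f := Int.natAbs) hi)]
  exact (hu i hi).2

/-- **Myhill's theorem** for additive cellular automata: if no nonzero finite configuration is
mapped to `0`, the automaton is surjective. -/
theorem surjective_of_injective_on_finite {G : Type*} [AddCommGroup G] [Fintype G]
    [TopologicalSpace G] [DiscreteTopology G] (H : (ℤ → G) →+ (ℤ → G)) (hH : Continuous H)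
    (hshift : ∀ (a : ℤ) (c : ℤ → G) (i : ℤ), H (fun j => c (j + a)) i = H c (i + a))
    (hfin : ∀ c : ℤ → G, {i : ℤ | c i ≠ 0}.Finite → H c = 0 → c = 0) :
    Function.Surjective H := by
  classical
  by_contra hns
  obtain ⟨r, hr⟩ := exists_radius_of_continuous H hH
  obtain ⟨s, y, hy⟩ := exists_orphan_of_not_surjective hH hns
  have hrad (c : ℤ → G) (i : ℤ) (h : ∀ j : ℤ, (j - i).natAbs ≤ r → c j = 0) : H c i = 0 := by
    have := hshift i c 0
    rw [zero_add] at this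
    rw [← this]
    exact hr _ fun j hj => h _ (by simpa using hj)
  set m := 2 * s + 1 with hm
  set q := Fintype.card G with hq
  have hqpos : 0 < q := Fintype.card_pos
  obtain ⟨k, hk⟩ : ∃ k, k = (q ^ m - 1) * q ^ (2 * r) + 2 * r + 1 := ⟨_, rfl⟩
  have hkm : 2 * r ≤ k * m :=
    (by omega : 2 * r ≤ k).trans (Nat.le_mul_of_pos_right k (by omega))
  obtain ⟨N, hN⟩ : ∃ N, k * m = N + 2 * r := ⟨k * m - 2 * r, by omega⟩
  let e : (Fin N → G) → ℤ → G := fun u i =>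
    if h : 0 ≤ i ∧ i < N then u ⟨i.toNat, by omega⟩ else 0
  let p₀ : Fin m → G := fun t => y ((t : ℤ) - s)
  have horphan (c : ℤ → G) (a : ℤ) : (fun t : Fin m => H c (a + t)) ≠ p₀ := by
    intro h
    obtain ⟨i, hi, hne⟩ := hy (fun j => c (j + (a + s)))
    apply hne
    rw [hshift]
    have := congrFun h ⟨(i + s).toNat, by omega⟩
    simp only [p₀] at this
    rw [Int.toNat_of_nonneg (by omega)] at this
    rw [show i + (a + s) = a + (i + s) by ring, this, add_sub_cancel_right]
  let Φ : (Fin N → G) → Fin k → {p : Fin m → G // p ≠ p₀} := fun u j =>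
    ⟨fun t => H (e u) ((j : ℤ) * m - r + t), horphan _ _⟩
  have hsupp (u : Fin N → G) (i : ℤ) (hi : i < -r ∨ (N : ℤ) + r ≤ i) : H (e u) i = 0 := by
    refine hrad _ _ fun j hj => dif_neg ?_
    omega
  have hΦ : Function.Injective Φ := by
    intro u v huv
    have hHeq : H (e u) = H (e v) := by
      funext i
      by_cases hi : i < -r ∨ (N : ℤ) + r ≤ i
      · rw [hsupp u i hi, hsupp v i hi]
      · obtain ⟨l, hl⟩ : ∃ l : ℕ, i = l - r := ⟨(i + r).toNat, by omega⟩
        have hlt : l < k * m := by omega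
        have hdiv : l / m < k := Nat.div_lt_of_lt_mul (by rwa [mul_comm])
        have h := congrFun (congrArg Subtype.val (congrFun huv ⟨l / m, hdiv⟩))
          ⟨l % m, Nat.mod_lt _ (by omega)⟩
        have hpos : ((l / m : ℕ) : ℤ) * m - r + ((l % m : ℕ) : ℤ) = i := by
          have : ((l / m * m + l % m : ℕ) : ℤ) = l := by rw [Nat.div_add_mod']
          push_cast at this ⊢
          linarith
        simp only [Φ] at h
        rwa [hpos] at h
    have hzero : e u - e v = 0 := by
      refine hfin _ ((Set.finite_Ico (0 : ℤ) N).subset fun i hi => ?_) ?_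
      · by_contra hnot
        have hnot' : ¬ (0 ≤ i ∧ i < N) := hnot
        exact hi (by simp [e, hnot'])
      · rw [map_sub, hHeq, sub_self]
    funext t
    have h := congrFun (sub_eq_zero.1 hzero) (t : ℤ)
    simpa [e] using h
  have hcard := Fintype.card_le_of_injective Φ hΦ
  have hsub : Fintype.card {p : Fin m → G // p ≠ p₀} = q ^ m - 1 := by
    simp [Fintype.card_subtype_compl, hq]
  rw [Fintype.card_fun, Fintype.card_fun, hsub, Fintype.card_fin, Fintype.card_fin] at hcard
  have hlt := mul_pow_lt_succ_pow (q ^ m - 1) (q ^ (2 * r)) k (by omega)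
  rw [Nat.sub_add_cancel (Nat.pow_pos hqpos), ← pow_mul, mul_comm m k, hN,
    pow_add q N, mul_comm] at hlt
  exact absurd hcard (not_le.2 (Nat.lt_of_mul_lt_mul_right hlt))

/-- if `F^n - I` is not surjective, then `F^n` has a nonzero finite fixed
configuration. -/
theorem finite_periodic_of_not_surjective {G : Type*} [AddCommGroup G] [Fintype G]
    (F : (ℤ → G) → (ℤ → G))
    (hcont : Continuous[configTop G, configTop G] F)
    (hshift : F ∘ shiftMap G = shiftMap G ∘ F)
    (hhom : ∀ c c' : ℤ → G, F (c + c') = F c + F c')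
    (hinj : Function.Injective F)
    (n : ℕ) (hn : 1 ≤ n)
    (hns : ¬ Function.Surjective (fun c : ℤ → G => F^[n] c - c)) :
    ∃ c : ℤ → G, {i : ℤ | c i ≠ 0}.Finite ∧ c ≠ (fun _ => 0) ∧ F^[n] c = c := by
  let : TopologicalSpace G := ⊥
  have : DiscreteTopology G := ⟨rfl⟩
  have hcont' : Continuous F := hcont
  let f : (ℤ → G) →+ (ℤ → G) := AddMonoidHom.mk' F hhom
  let H : (ℤ → G) →+ (ℤ → G) :=
    AddMonoidHom.mk' (fun c => F^[n] c - c) fun c c' => by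
      have h : F^[n] (c + c') = F^[n] c + F^[n] c' := iterate_map_add f n c c'
      simp only [h]
      abel
  have hH : Continuous H := (hcont'.iterate n).sub continuous_id
  have hiter : F^[n] ∘ shiftMap G = shiftMap G ∘ F^[n] :=
    funext (Function.Commute.iterate_left (f := F) (g := shiftMap G) (congrFun hshift) n)
  by_contra! hno
  refine hns (surjective_of_injective_on_finite H hH (fun a c i => ?_) fun c hc h => ?_)
  · exact congrArg (· - c (i + a)) (translate_of_comp_shiftMap hiter a c i)
  · by_contra hne
    exact hno c hc hne (sub_eq_zero.1 h)
end

section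
/- Let G = (ℤ/2ℤ) × (ℤ/2ℤ) and define F : G^ℤ → G^ℤ by F(c)_i = (c_i.2, c_i.1 + c_{i−1}.2), where c_i = (c_i.1, c_i.2) ∈ G. Then F is a bijective group cellular automaton on G (with inverse given by F^{−1}(d)_i = (d_{i−1}.1 + d_i.2, d_i.1)), F is topologically transitive, but F is not expansive. In particular, there exists a topologically transitive injective group cellular automaton that is not expansive. -/
open Function Topology

/-- The example GCA on `G = (ℤ/2ℤ) × (ℤ/2ℤ)`: `F(c)_i = (c_i.2, c_i.1 + c_{i-1}.2)`. -/
def exF : (ℤ → ZMod 2 × ZMod 2) → (ℤ → ZMod 2 × ZMod 2) :=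
  fun c i => ((c i).2, (c i).1 + (c (i - 1)).2)

/-- Its inverse: `F⁻¹(d)_i = (d_{i-1}.1 + d_i.2, d_i.1)`. -/
def exFinv : (ℤ → ZMod 2 × ZMod 2) → (ℤ → ZMod 2 × ZMod 2) :=
  fun d i => ((d (i - 1)).1 + (d i).2, (d i).1)

theorem exF_exFinv (d : ℤ → ZMod 2 × ZMod 2) : exF (exFinv d) = d := by
  funext i
  refine Prod.ext rfl ?_
  simp only [exF, exFinv]
  rw [add_right_comm, CharTwo.add_self_eq_zero, zero_add]

theorem exFinv_exF (c : ℤ → ZMod 2 × ZMod 2) : exFinv (exF c) = c := by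
  funext i
  refine Prod.ext ?_ rfl
  simp only [exF, exFinv]
  rw [add_left_comm, CharTwo.add_self_eq_zero, add_zero]

theorem bijective_exF : Function.Bijective exF :=
  ⟨Function.LeftInverse.injective exFinv_exF, Function.RightInverse.surjective exF_exFinv⟩

theorem continuous_configTop_of_local {A : Type*} (f : A × A → A) :
    Continuous[configTop A, configTop A] fun c i => f (c i, c (i - 1)) := by
  let _ : TopologicalSpace A := ⊥
  have _ : DiscreteTopology A := ⟨rfl⟩
  change Continuous fun (c : ℤ → A) i => f (c i, c (i - 1))
  exact continuous_pi fun i => continuous_of_discreteTopology.comp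
    ((continuous_apply i).prodMk (continuous_apply (i - 1)))

theorem continuous_exF :
    Continuous[configTop (ZMod 2 × ZMod 2), configTop (ZMod 2 × ZMod 2)] exF :=
  continuous_configTop_of_local fun p => (p.1.2, p.1.1 + p.2.2)

theorem exF_comp_shiftMap :
    exF ∘ shiftMap (ZMod 2 × ZMod 2) = shiftMap (ZMod 2 × ZMod 2) ∘ exF := by
  funext c i
  simp [exF, shiftMap]

theorem exF_add (c c' : ℤ → ZMod 2 × ZMod 2) : exF (c + c') = exF c + exF c' := by
  funext i
  refine Prod.ext rfl ?_
  simp only [exF, Pi.add_apply, Prod.snd_add, Prod.fst_add]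
  ring

/-- An open set containing `x` contains every configuration agreeing with `x` on a
sufficiently large window. -/
theorem exists_window_of_isOpen {A : Type*} {U : Set (ℤ → A)} (hU : IsOpen[configTop A] U)
    {x : ℤ → A} (hx : x ∈ U) :
    ∃ m : ℕ, ∀ y : ℤ → A, (∀ i : ℤ, i.natAbs ≤ m → y i = x i) → y ∈ U := by
  let _ : TopologicalSpace A := ⊥
  obtain ⟨I, u, hu, hsub⟩ := isOpen_pi_iff.1 hU x hx
  refine ⟨I.sup Int.natAbs, fun y hy => hsub fun i hi => ?_⟩
  rw [hy i (Finset.le_sup (f := Int.natAbs) hi)]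
  exact (hu i hi).2

/-- Configurations agreeing at all positions `i < k` are at distance at most `2 ^ (-k)`. -/
theorem tychDist_le {A : Type*} {c c' : ℤ → A} {k : ℕ} (h : ∀ i : ℤ, i < k → c i = c' i) :
    tychDist c c' ≤ (2 : ℝ) ^ (-(k : ℤ)) := by
  unfold tychDist
  split_ifs with hc
  · positivity
  · refine zpow_le_zpow_right₀ one_le_two (neg_le_neg (Int.ofNat_le.2 ?_))
    obtain ⟨j, hj⟩ := Function.ne_iff.1 hc
    refine le_csInf ⟨_, j, rfl, hj⟩ ?_
    rintro _ ⟨i, rfl, hi⟩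
    by_contra hlt
    exact hi (h i (by omega))

theorem exF_apply_eq_zero {k : ℤ} {c : ℤ → ZMod 2 × ZMod 2} (h : ∀ i < k, c i = 0) :
    ∀ i < k, exF c i = 0 := fun i hi => by
  simp [exF, h i hi, h (i - 1) (by omega)]

theorem exFinv_apply_eq_zero {k : ℤ} {c : ℤ → ZMod 2 × ZMod 2} (h : ∀ i < k, c i = 0) :
    ∀ i < k, exFinv c i = 0 := fun i hi => by
  simp [exFinv, h i hi, h (i - 1) (by omega)]

theorem invFun_exF : Function.invFun exF = exFinv :=
  funext fun d => bijective_exF.1 <| by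
    rw [exF_exFinv, Function.rightInverse_invFun bijective_exF.2 d]

theorem zIter_exF_apply_eq_zero (n : ℤ) {k : ℤ} {c : ℤ → ZMod 2 × ZMod 2}
    (h : ∀ i < k, c i = 0) : ∀ i < k, zIter exF n c i = 0 := by
  unfold zIter
  rw [invFun_exF]
  split_ifs
  · exact Function.Iterate.rec (fun c : ℤ → ZMod 2 × ZMod 2 => ∀ i < k, c i = 0) h
      (fun _ => exF_apply_eq_zero) _
  · exact Function.Iterate.rec (fun c : ℤ → ZMod 2 × ZMod 2 => ∀ i < k, c i = 0) h
      (fun _ => exFinv_apply_eq_zero) _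

theorem not_expansive_exF : ¬ Expansive exF := by
  rintro ⟨ε, hε, h⟩
  obtain ⟨k, hk⟩ := exists_pow_lt_of_lt_one hε (by norm_num : (2⁻¹ : ℝ) < 1)
  obtain ⟨n, hn⟩ := h (Pi.single (k : ℤ) (1, 0)) 0 (by simp)
  refine (hn.trans_le (tychDist_le (k := k) fun i hi => ?_)).not_ge ?_
  · rw [zIter_exF_apply_eq_zero n (fun j hj => Pi.single_eq_of_ne hj.ne _) i hi,
      zIter_exF_apply_eq_zero n (c := 0) (fun _ _ => rfl) i hi]
  · rw [zpow_neg, zpow_natCast, ← inv_pow]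
    exact hk.le

/-- `exF` as a permutation of the configuration space. -/
def exFPerm : Equiv.Perm (ℤ → ZMod 2 × ZMod 2) := ⟨exF, exFinv, exFinv_exF, exF_exFinv⟩

theorem exFPerm_zpow_add_one (c : ℤ → ZMod 2 × ZMod 2) (t : ℤ) :
    (exFPerm ^ (t + 1)) c = exF ((exFPerm ^ t) c) := by
  rw [add_comm, zpow_add, zpow_one]
  rfl

theorem exFPerm_zpow_apply_fst (c : ℤ → ZMod 2 × ZMod 2) (t i : ℤ) :
    ((exFPerm ^ t) c i).1 = ((exFPerm ^ (t - 1)) c i).2 := by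
  conv_lhs => rw [← sub_add_cancel t 1, exFPerm_zpow_add_one]
  rfl

theorem exFPerm_zpow_apply_sub_one_snd (c : ℤ → ZMod 2 × ZMod 2) (t i : ℤ) :
    ((exFPerm ^ t) c (i - 1)).2 =
      ((exFPerm ^ (t + 1)) c i).2 + ((exFPerm ^ (t - 1)) c i).2 := by
  rw [exFPerm_zpow_add_one, ← exFPerm_zpow_apply_fst]
  simp only [exF]
  rw [add_right_comm, CharTwo.add_self_eq_zero, zero_add]

/-- The column `j` places to the left of the column `z` in a space-time diagram of `exF`
(second components, indexed by time). -/
def leftColumn (z : ℤ → ZMod 2) : ℕ → ℤ → ZMod 2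
  | 0, t => z t
  | j + 1, t => leftColumn z j (t + 1) + leftColumn z j (t - 1)

theorem leftColumn_congr {z z' : ℤ → ZMod 2} (j : ℕ) :
    ∀ {t : ℤ}, (∀ s, t - j ≤ s → s ≤ t + j → z s = z' s) →
      leftColumn z j t = leftColumn z' j t := by
  induction j with
  | zero => exact fun h => h _ (by simp) (by simp)
  | succ j ih =>
    intro t h
    simp only [leftColumn]
    rw [ih fun s h₁ h₂ => h s (by push_cast; omega) (by push_cast; omega),
      ih fun s h₁ h₂ => h s (by push_cast; omega) (by push_cast; omega)]

theorem leftColumn_shift (z : ℤ → ZMod 2) (n : ℤ) (j : ℕ) :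
    ∀ t : ℤ, leftColumn (fun s => z (s - n)) j t = leftColumn z j (t - n) := by
  induction j with
  | zero => exact fun _ => rfl
  | succ j ih =>
    intro t
    simp only [leftColumn, ih]
    rw [add_sub_right_comm, sub_right_comm]

theorem leftColumn_orbit (c : ℤ → ZMod 2 × ZMod 2) (m : ℤ) (j : ℕ) :
    ∀ t : ℤ, leftColumn (fun s => ((exFPerm ^ s) c m).2) j t =
      ((exFPerm ^ t) c (m - j)).2 := by
  induction j with
  | zero => simp [leftColumn]
  | succ j ih =>
    intro t
    rw [leftColumn, ih, ih, ← exFPerm_zpow_apply_sub_one_snd, Nat.cast_succ,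
      sub_add_eq_sub_sub]

/-- The configuration whose orbit has `z` as its column at position `m`. -/
def ofColumn (z : ℤ → ZMod 2) (m : ℤ) : ℤ → ZMod 2 × ZMod 2 := fun i =>
  if i ≤ m then (leftColumn z (m - i).toNat (-1), leftColumn z (m - i).toNat 0) else 0

theorem iterate_exF_ofColumn (z : ℤ → ZMod 2) (m : ℤ) (n : ℕ) :
    ∀ i ≤ m, exF^[n] (ofColumn z m) i =
      (leftColumn z (m - i).toNat (n - 1), leftColumn z (m - i).toNat n) := by
  induction n with
  | zero => exact fun i hi => by simp [ofColumn, hi]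
  | succ n ih =>
    intro i hi
    rw [Function.iterate_succ_apply']
    simp only [exF]
    rw [ih i hi, ih (i - 1) (by omega), show (m - (i - 1)).toNat = (m - i).toNat + 1 by omega]
    refine Prod.ext ?_ ?_
    · simp
    · simp only [leftColumn, Nat.cast_add, Nat.cast_one]
      rw [add_left_comm, CharTwo.add_self_eq_zero, add_zero]

/-- If a column `z` follows, around time `n`, the column of the orbit of `c` around time `0`,
then the `n`-th iterate of `ofColumn z m` agrees with `c` on a window ending at `m`. -/
theorem iterate_exF_ofColumn_eq {z : ℤ → ZMod 2} {c : ℤ → ZMod 2 × ZMod 2} {m i : ℤ} {n : ℕ}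
    (hi : i ≤ m)
    (hz : ∀ s : ℤ, n - 1 - (m - i) ≤ s → s ≤ n + (m - i) →
      z s = ((exFPerm ^ (s - n)) c m).2) :
    exF^[n] (ofColumn z m) i = c i := by
  have key : ∀ t : ℤ, n - 1 ≤ t → t ≤ n →
      leftColumn z (m - i).toNat t = ((exFPerm ^ (t - n)) c i).2 := by
    intro t h₁ h₂
    rw [leftColumn_congr (z' := fun s => ((exFPerm ^ (s - n)) c m).2) _
      fun s h₃ h₄ => hz s (by omega) (by omega),
      leftColumn_shift (fun s => ((exFPerm ^ s) c m).2), leftColumn_orbit,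
      Int.toNat_of_nonneg (sub_nonneg.2 hi), sub_sub_cancel]
  rw [iterate_exF_ofColumn z m n i hi, key _ le_rfl (by omega), key _ (by omega) le_rfl,
    sub_right_comm, sub_self, ← exFPerm_zpow_apply_fst]
  rfl

theorem topTransitive_exF : TopTransitive exF := by
  rintro U V hU hV ⟨x, hx⟩ ⟨y, hy⟩
  obtain ⟨m₁, hm₁⟩ := exists_window_of_isOpen hU hx
  obtain ⟨m₂, hm₂⟩ := exists_window_of_isOpen hV hy
  obtain ⟨m, h₁, h₂⟩ : ∃ m : ℕ, m₁ ≤ m ∧ m₂ ≤ m := ⟨_, le_max_left _ _, le_max_right _ _⟩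
  let n : ℕ := 4 * m + 2
  let z : ℤ → ZMod 2 := fun s =>
    if s ≤ 2 * m then ((exFPerm ^ s) x m).2 else ((exFPerm ^ (s - n)) y m).2
  refine ⟨n, _, ⟨ofColumn z m, hm₁ _ fun i hi => ?_, rfl⟩, hm₂ _ fun i hi => ?_⟩
  · refine iterate_exF_ofColumn_eq (n := 0) (by omega) fun s _ hs => ?_
    rw [Nat.cast_zero, sub_zero]
    exact if_pos (by omega)
  · exact iterate_exF_ofColumn_eq (by omega) fun s hs _ => if_neg (by omega)

/-- `exF` is a bijective GCA (with inverse `exFinv`) that is topologically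
transitive but not expansive; in particular, there exists a topologically transitive
injective GCA that is not expansive. -/
theorem exF_transitive_not_expansive :
    (Function.Bijective exF ∧
     Continuous[configTop (ZMod 2 × ZMod 2), configTop (ZMod 2 × ZMod 2)] exF ∧
     exF ∘ shiftMap (ZMod 2 × ZMod 2) = shiftMap (ZMod 2 × ZMod 2) ∘ exF ∧
     (∀ c c' : ℤ → ZMod 2 × ZMod 2, exF (c + c') = exF c + exF c') ∧
     (∀ d, exF (exFinv d) = d) ∧ (∀ c, exFinv (exF c) = c) ∧
     TopTransitive exF ∧ ¬ Expansive exF) ∧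
    ∃ (G : Type) (_ : AddCommGroup G) (_ : Fintype G)
      (F : (ℤ → G) → (ℤ → G)),
        Continuous[configTop G, configTop G] F ∧
        F ∘ shiftMap G = shiftMap G ∘ F ∧
        (∀ c c' : ℤ → G, F (c + c') = F c + F c') ∧
        Function.Injective F ∧
        TopTransitive F ∧ ¬ Expansive F := by
  exact ⟨⟨bijective_exF, continuous_exF, exF_comp_shiftMap, exF_add, exF_exFinv, exFinv_exF,
    topTransitive_exF, not_expansive_exF⟩,
    ZMod 2 × ZMod 2, inferInstance, inferInstance, exF, continuous_exF, exF_comp_shiftMap,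
    exF_add, bijective_exF.1, topTransitive_exF, not_expansive_exF⟩
end
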